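/- Standardizing reductions: for any φ-terms t, r, s such that t ⇛ᵢ r and r →h s, there exists a φ-term q such that t →h* q and q ⇛ᵢ s. -/

import Mathlib

namespace PhiCalc

/-- φ-terms over a set of attribute labels `L`. An object term carries a finite
list of attributes: `(a, none)` is a void attribute, `(b, some t)` is an
attached attribute. -/
inductive Tm (L : Type) : Type where
  | loc : Nat → Tm L
  | dot : Tm L → L → Tm L
  | app : Tm L → L → Tm L → Tm L
  | obj : List (L × Option (Tm L)) → Tm L

namespace Tm

variable {L : Type}

/-- Look up a label among the attributes of an object:
`none` = the label is missing, `some none` = void attribute,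
`some (some t)` = attribute attached to `t`. -/
def lookupAttr [DecidableEq L] (a : L) : List (L × Option (Tm L)) → Option (Option (Tm L))
  | [] => none
  | (b, o) :: rest => if a = b then some o else lookupAttr a rest

/-- Attach term `u` to the (first occurrence of) label `a`. -/
def attachAttr [DecidableEq L] (a : L) (u : Tm L) :
    List (L × Option (Tm L)) → List (L × Option (Tm L))
  | [] => []
  | (b, o) :: rest => if a = b then (b, some u) :: rest else (b, o) :: attachAttr a u rest

mutual
/-- Locator increment `↑ₙ t`. -/
def incAt : Nat → Tm L → Tm L
  | n, loc m => if m < n then loc m else loc (m + 1)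
  | n, dot t a => dot (incAt n t) a
  | n, app t a u => app (incAt n t) a (incAt n u)
  | n, obj attrs => obj (incAtList (n + 1) attrs)

def incAtList : Nat → List (L × Option (Tm L)) → List (L × Option (Tm L))
  | _, [] => []
  | n, (a, none) :: rest => (a, none) :: incAtList n rest
  | n, (a, some t) :: rest => (a, some (incAt n t)) :: incAtList n rest
end

mutual
/-- Locator substitution `t[ρ^n ↦ u]`. -/
def subst : Tm L → Nat → Tm L → Tm L
  | loc m, n, u => if m < n then loc m else if m = n then u else loc (m - 1)
  | dot t a, n, u => dot (subst t n u) a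
  | app t a v, n, u => app (subst t n u) a (subst v n u)
  | obj attrs, n, u => obj (substList attrs (n + 1) (incAt 0 u))

def substList : List (L × Option (Tm L)) → Nat → Tm L → List (L × Option (Tm L))
  | [], _, _ => []
  | (a, none) :: rest, n, u => (a, none) :: substList rest n u
  | (a, some t) :: rest, n, u => (a, some (subst t n u)) :: substList rest n u
end

section Reductions

variable [DecidableEq L]

/-- One-step (regular) reduction `⇝`, parametrized by the decorator label `phi`. -/
inductive Step (phi : L) : Tm L → Tm L → Prop where
  | congObj {t t' : Tm L} (pre post : List (L × Option (Tm L))) (b : L) :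
      Step phi t t' →
      Step phi (obj (pre ++ (b, some t) :: post)) (obj (pre ++ (b, some t') :: post))
  | congDot {t t' : Tm L} (a : L) : Step phi t t' → Step phi (dot t a) (dot t' a)
  | congAppL {t t' u : Tm L} (a : L) : Step phi t t' → Step phi (app t a u) (app t' a u)
  | congAppR {t u u' : Tm L} (a : L) : Step phi u u' → Step phi (app t a u) (app t a u')
  | dotStep {attrs : List (L × Option (Tm L))} {c : L} {tc : Tm L} :
      lookupAttr c attrs = some (some tc) →
      Step phi (dot (obj attrs) c) (subst tc 0 (obj attrs))
  | dotPhi {attrs : List (L × Option (Tm L))} {c : L} :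
      lookupAttr c attrs = none → (lookupAttr phi attrs).isSome →
      Step phi (dot (obj attrs) c) (dot (dot (obj attrs) phi) c)
  | appStep {attrs : List (L × Option (Tm L))} {c : L} {u : Tm L} :
      lookupAttr c attrs = some none →
      Step phi (app (obj attrs) c u) (obj (attachAttr c (incAt 0 u) attrs))

mutual
/-- Parallel reduction `⇛`. -/
inductive Par (phi : L) : Tm L → Tm L → Prop where
  | loc (n : Nat) : Par phi (Tm.loc n) (Tm.loc n)
  | obj {attrs attrs' : List (L × Option (Tm L))} :
      ParAttrs phi attrs attrs' → Par phi (Tm.obj attrs) (Tm.obj attrs')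
  | congDot {t t' : Tm L} (a : L) : Par phi t t' → Par phi (Tm.dot t a) (Tm.dot t' a)
  | congApp {t t' u u' : Tm L} (a : L) :
      Par phi t t' → Par phi u u' → Par phi (Tm.app t a u) (Tm.app t' a u')
  | dotPar {t : Tm L} {attrs : List (L × Option (Tm L))} {c : L} {tc : Tm L} :
      Par phi t (Tm.obj attrs) → lookupAttr c attrs = some (some tc) →
      Par phi (Tm.dot t c) (subst tc 0 (Tm.obj attrs))
  | dotPhi {t : Tm L} {attrs : List (L × Option (Tm L))} {c : L} :
      Par phi t (Tm.obj attrs) → lookupAttr c attrs = none →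
      (lookupAttr phi attrs).isSome →
      Par phi (Tm.dot t c) (Tm.dot (Tm.dot (Tm.obj attrs) phi) c)
  | appPar {t : Tm L} {attrs : List (L × Option (Tm L))} {c : L} {u u' : Tm L} :
      Par phi t (Tm.obj attrs) → lookupAttr c attrs = some none → Par phi u u' →
      Par phi (Tm.app t c u) (Tm.obj (attachAttr c (incAt 0 u') attrs))

/-- Pointwise parallel reduction on attribute lists: void attributes are kept,
attached attributes reduce in parallel. -/
inductive ParAttrs (phi : L) :
    List (L × Option (Tm L)) → List (L × Option (Tm L)) → Prop where
  | nil : ParAttrs phi [] []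
  | void {rest rest' : List (L × Option (Tm L))} (a : L) :
      ParAttrs phi rest rest' → ParAttrs phi ((a, none) :: rest) ((a, none) :: rest')
  | attached {t t' : Tm L} {rest rest' : List (L × Option (Tm L))} (a : L) :
      Par phi t t' → ParAttrs phi rest rest' →
      ParAttrs phi ((a, some t) :: rest) ((a, some t') :: rest')
end

/-- Head reduction `→h`. -/
inductive Head (phi : L) : Tm L → Tm L → Prop where
  | dotStep {attrs : List (L × Option (Tm L))} {c : L} {tc : Tm L} :
      lookupAttr c attrs = some (some tc) →
      Head phi (dot (obj attrs) c) (subst tc 0 (obj attrs))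
  | dotPhi {attrs : List (L × Option (Tm L))} {c : L} :
      lookupAttr c attrs = none → (lookupAttr phi attrs).isSome →
      Head phi (dot (obj attrs) c) (dot (dot (obj attrs) phi) c)
  | appStep {attrs : List (L × Option (Tm L))} {c : L} {u : Tm L} :
      lookupAttr c attrs = some none →
      Head phi (app (obj attrs) c u) (obj (attachAttr c (incAt 0 u) attrs))
  | congDot {t t' : Tm L} (a : L) : Head phi t t' → Head phi (dot t a) (dot t' a)
  | congApp {t t' u : Tm L} (a : L) : Head phi t t' → Head phi (app t a u) (app t' a u)

/-- Internal parallel reduction `⇛ᵢ`. -/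
inductive ParI (phi : L) : Tm L → Tm L → Prop where
  | loc (n : Nat) : ParI phi (Tm.loc n) (Tm.loc n)
  | obj {attrs attrs' : List (L × Option (Tm L))} :
      ParAttrs phi attrs attrs' → ParI phi (Tm.obj attrs) (Tm.obj attrs')
  | congDot {t t' : Tm L} (a : L) : ParI phi t t' → ParI phi (Tm.dot t a) (Tm.dot t' a)
  | congApp {t t' u u' : Tm L} (a : L) :
      ParI phi t t' → Par phi u u' → ParI phi (Tm.app t a u) (Tm.app t' a u')

/-- Internal (regular) reduction `→ᵢ`. -/
inductive StepI (phi : L) : Tm L → Tm L → Prop where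
  | congObj {t t' : Tm L} (pre post : List (L × Option (Tm L))) (b : L) :
      Step phi t t' →
      StepI phi (obj (pre ++ (b, some t) :: post)) (obj (pre ++ (b, some t') :: post))
  | congDot {t t' : Tm L} (a : L) : StepI phi t t' → StepI phi (dot t a) (dot t' a)
  | congAppL {t t' u : Tm L} (a : L) : StepI phi t t' → StepI phi (app t a u) (app t' a u)
  | congAppR {t u u' : Tm L} (a : L) : Step phi u u' → StepI phi (app t a u) (app t a u')

end Reductions

end Tm

end PhiCalc
namespace PhiCalc
namespace Tm
section Extra
variable {L : Type} [DecidableEq L]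

mutual
/-- Complete development `t⁺`. -/
def cd (phi : L) : Tm L → Tm L
  | loc n => loc n
  | dot t a =>
    match cd phi t with
    | obj attrs =>
      match lookupAttr a attrs with
      | some (some ta) => subst ta 0 (obj attrs)
      | some none => dot (obj attrs) a
      | none =>
        if (lookupAttr phi attrs).isSome then dot (dot (obj attrs) phi) a
        else dot (obj attrs) a
    | t' => dot t' a
  | app t a u =>
    match cd phi t with
    | obj attrs =>
      match lookupAttr a attrs with
      | some none => obj (attachAttr a (incAt 0 (cd phi u)) attrs)
      | _ => app (obj attrs) a (cd phi u)
    | t' => app t' a (cd phi u)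
  | obj attrs => obj (cdList phi attrs)

def cdList (phi : L) : List (L × Option (Tm L)) → List (L × Option (Tm L))
  | [] => []
  | (a, none) :: rest => (a, none) :: cdList phi rest
  | (a, some t) :: rest => (a, some (cd phi t)) :: cdList phi rest
end

/-- Head reduction as a (deterministic) partial function. -/
def headRed (phi : L) : Tm L → Option (Tm L)
  | loc _ => none
  | obj _ => none
  | dot t a =>
    match t with
    | obj attrs =>
      match lookupAttr a attrs with
      | some (some ta) => some (subst ta 0 (obj attrs))
      | some none => none
      | none =>
        if (lookupAttr phi attrs).isSome then some (dot (dot (obj attrs) phi) a)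
        else none
    | t => (headRed phi t).map (fun t' => dot t' a)
  | app t a u =>
    match t with
    | obj attrs =>
      match lookupAttr a attrs with
      | some none => some (obj (attachAttr a (incAt 0 u) attrs))
      | _ => none
    | t => (headRed phi t).map (fun t' => app t' a u)

mutual
/-- Normal order reduction `⇝ℓ` as a (deterministic) partial function:
head reduction first, otherwise reduce the leftmost subterm that reduces. -/
def nordRed (phi : L) : Tm L → Option (Tm L)
  | loc _ => none
  | dot t a =>
    match headRed phi (dot t a) with
    | some s => some s
    | none => (nordRed phi t).map (fun t' => dot t' a)
  | app t a u =>
    match headRed phi (app t a u) with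
    | some s => some s
    | none =>
      match nordRed phi t with
      | some t' => some (app t' a u)
      | none => (nordRed phi u).map (fun u' => app t a u')
  | obj attrs => (nordList phi attrs).map obj

def nordList (phi : L) : List (L × Option (Tm L)) → Option (List (L × Option (Tm L)))
  | [] => none
  | (a, none) :: rest => (nordList phi rest).map (fun rest' => (a, none) :: rest')
  | (a, some t) :: rest =>
    match nordRed phi t with
    | some t' => some ((a, some t') :: rest)
    | none => (nordList phi rest).map (fun rest' => (a, some t) :: rest')
end

/-- Normal order reduction relation. -/
def NOrd (phi : L) (t t' : Tm L) : Prop := nordRed phi t = some t'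

end Extra
end Tm
end PhiCalc
namespace PhiCalc
namespace Tm

section Locators
variable {L : Type}

mutual
theorem incAt_incAt : ∀ (t : Tm L) {k n : Nat}, k ≤ n →
    incAt (n + 1) (incAt k t) = incAt k (incAt n t)
  | loc m, k, n, h => by grind [incAt]
  | dot t a, k, n, h => by simp only [incAt, incAt_incAt t h]
  | app t a u, k, n, h => by simp only [incAt, incAt_incAt t h, incAt_incAt u h]
  | obj l, k, n, h => by simp only [incAt, incAtList_incAtList l (Nat.succ_le_succ h)]

theorem incAtList_incAtList : ∀ (l : List (L × Option (Tm L))) {k n : Nat}, k ≤ n →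
    incAtList (n + 1) (incAtList k l) = incAtList k (incAtList n l)
  | [], k, n, h => by simp only [incAtList]
  | (a, none) :: l, k, n, h => by simp only [incAtList, incAtList_incAtList l h]
  | (a, some t) :: l, k, n, h => by
    simp only [incAtList, incAtList_incAtList l h, incAt_incAt t h]
end

mutual
theorem subst_incAt_self : ∀ (t : Tm L) (k : Nat) (u : Tm L), subst (incAt k t) k u = t
  | loc m, k, u => by grind [incAt, subst]
  | dot t a, k, u => by simp only [incAt, subst, subst_incAt_self t]
  | app t a v, k, u => by simp only [incAt, subst, subst_incAt_self t, subst_incAt_self v]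
  | obj l, k, u => by simp only [incAt, subst, substList_incAtList_self l]

theorem substList_incAtList_self : ∀ (l : List (L × Option (Tm L))) (k : Nat) (u : Tm L),
    substList (incAtList k l) k u = l
  | [], k, u => by simp only [incAtList, substList]
  | (a, none) :: l, k, u => by simp only [incAtList, substList, substList_incAtList_self l]
  | (a, some t) :: l, k, u => by
    simp only [incAtList, substList, substList_incAtList_self l, subst_incAt_self t]
end

mutual
theorem incAt_subst : ∀ (t : Tm L) {k n : Nat} (u : Tm L), k ≤ n →
    incAt n (subst t k u) = subst (incAt (n + 1) t) k (incAt n u)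
  | loc m, k, n, u, h => by grind [incAt, subst]
  | dot t a, k, n, u, h => by simp only [incAt, subst, incAt_subst t u h]
  | app t a v, k, n, u, h => by simp only [incAt, subst, incAt_subst t u h, incAt_subst v u h]
  | obj l, k, n, u, h => by
    simp only [incAt, subst, incAtList_substList l _ (Nat.succ_le_succ h),
      incAt_incAt u (Nat.zero_le n)]

theorem incAtList_substList : ∀ (l : List (L × Option (Tm L))) {k n : Nat} (u : Tm L), k ≤ n →
    incAtList n (substList l k u) = substList (incAtList (n + 1) l) k (incAt n u)
  | [], k, n, u, h => by simp only [incAtList, substList]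
  | (a, none) :: l, k, n, u, h => by
    simp only [incAtList, substList, incAtList_substList l u h]
  | (a, some t) :: l, k, n, u, h => by
    simp only [incAtList, substList, incAtList_substList l u h, incAt_subst t u h]
end

mutual
theorem subst_incAt : ∀ (t : Tm L) {k n : Nat} (u : Tm L), k ≤ n →
    subst (incAt k t) (n + 1) (incAt k u) = incAt k (subst t n u)
  | loc m, k, n, u, h => by grind [incAt, subst]
  | dot t a, k, n, u, h => by simp only [incAt, subst, subst_incAt t u h]
  | app t a v, k, n, u, h => by simp only [incAt, subst, subst_incAt t u h, subst_incAt v u h]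
  | obj l, k, n, u, h => by
    simp only [incAt, subst, ← substList_incAtList l _ (Nat.succ_le_succ h),
      incAt_incAt u (Nat.zero_le k)]

theorem substList_incAtList : ∀ (l : List (L × Option (Tm L))) {k n : Nat} (u : Tm L), k ≤ n →
    substList (incAtList k l) (n + 1) (incAt k u) = incAtList k (substList l n u)
  | [], k, n, u, h => by simp only [incAtList, substList]
  | (a, none) :: l, k, n, u, h => by
    simp only [incAtList, substList, substList_incAtList l u h]
  | (a, some t) :: l, k, n, u, h => by
    simp only [incAtList, substList, substList_incAtList l u h, subst_incAt t u h]
end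

mutual
theorem subst_subst : ∀ (t : Tm L) {k n : Nat} (v u : Tm L), k ≤ n →
    subst (subst t k v) n u = subst (subst t (n + 1) (incAt k u)) k (subst v n u)
  | loc m, k, n, v, u, h => by grind [subst, subst_incAt_self]
  | dot t a, k, n, v, u, h => by simp only [subst, subst_subst t v u h]
  | app t a w, k, n, v, u, h => by
    simp only [subst, subst_subst t v u h, subst_subst w v u h]
  | obj l, k, n, v, u, h => by
    simp only [subst, substList_substList l _ _ (Nat.succ_le_succ h),
      incAt_incAt u (Nat.zero_le k), subst_incAt v u (Nat.zero_le n)]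

theorem substList_substList : ∀ (l : List (L × Option (Tm L))) {k n : Nat} (v u : Tm L), k ≤ n →
    substList (substList l k v) n u =
      substList (substList l (n + 1) (incAt k u)) k (subst v n u)
  | [], k, n, v, u, h => by simp only [substList]
  | (a, none) :: l, k, n, v, u, h => by simp only [substList, substList_substList l v u h]
  | (a, some t) :: l, k, n, v, u, h => by
    simp only [substList, substList_substList l v u h, subst_subst t v u h]
end

variable [DecidableEq L]

theorem lookupAttr_incAtList (c : L) (n : Nat) : ∀ l : List (L × Option (Tm L)),
    lookupAttr c (incAtList n l) = (lookupAttr c l).map (Option.map (incAt n))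
  | [] => by simp [incAtList, lookupAttr]
  | (a, none) :: l => by
    have := lookupAttr_incAtList c n l
    by_cases h : c = a <;> simp [incAtList, lookupAttr, h, this]
  | (a, some t) :: l => by
    have := lookupAttr_incAtList c n l
    by_cases h : c = a <;> simp [incAtList, lookupAttr, h, this]

theorem lookupAttr_substList (c : L) (n : Nat) (u : Tm L) : ∀ l : List (L × Option (Tm L)),
    lookupAttr c (substList l n u) = (lookupAttr c l).map (Option.map (subst · n u))
  | [] => by simp [substList, lookupAttr]
  | (a, none) :: l => by
    have := lookupAttr_substList c n u l
    by_cases h : c = a <;> simp [substList, lookupAttr, h, this]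
  | (a, some t) :: l => by
    have := lookupAttr_substList c n u l
    by_cases h : c = a <;> simp [substList, lookupAttr, h, this]

theorem incAtList_attachAttr (c : L) (n : Nat) (u : Tm L) : ∀ l : List (L × Option (Tm L)),
    incAtList n (attachAttr c u l) = attachAttr c (incAt n u) (incAtList n l)
  | [] => by simp [incAtList, attachAttr]
  | (a, none) :: l => by
    have := incAtList_attachAttr c n u l
    by_cases h : c = a <;> simp [incAtList, attachAttr, h, this]
  | (a, some t) :: l => by
    have := incAtList_attachAttr c n u l
    by_cases h : c = a <;> simp [incAtList, attachAttr, h, this]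

theorem substList_attachAttr (c : L) (n : Nat) (u v : Tm L) : ∀ l : List (L × Option (Tm L)),
    substList (attachAttr c u l) n v = attachAttr c (subst u n v) (substList l n v)
  | [] => by simp [substList, attachAttr]
  | (a, none) :: l => by
    have := substList_attachAttr c n u v l
    by_cases h : c = a <;> simp [substList, attachAttr, h, this]
  | (a, some t) :: l => by
    have := substList_attachAttr c n u v l
    by_cases h : c = a <;> simp [substList, attachAttr, h, this]

end Locators

section Reductions
variable {L : Type} [DecidableEq L] {phi : L}

theorem Head.incAt {t s : Tm L} (h : Head phi t s) (n : Nat) :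
    Head phi (t.incAt n) (s.incAt n) := by
  induction h with
  | dotStep h =>
    rw [incAt_subst _ _ (Nat.zero_le n)]
    exact .dotStep (by simp [lookupAttr_incAtList, h])
  | dotPhi h h' =>
    exact .dotPhi (by simp [lookupAttr_incAtList, h]) (by simpa [lookupAttr_incAtList] using h')
  | appStep h =>
    simp only [Tm.incAt, incAtList_attachAttr, incAt_incAt _ (Nat.zero_le n)]
    exact .appStep (by simp [lookupAttr_incAtList, h])
  | congDot a _ ih => exact .congDot a ih
  | congApp a _ ih => exact .congApp a ih

theorem Head.subst {t s : Tm L} (h : Head phi t s) (n : Nat) (u : Tm L) :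
    Head phi (t.subst n u) (s.subst n u) := by
  induction h with
  | dotStep h =>
    rw [subst_subst _ _ _ (Nat.zero_le n)]
    exact .dotStep (by simp [lookupAttr_substList, h])
  | dotPhi h h' =>
    exact .dotPhi (by simp [lookupAttr_substList, h]) (by simpa [lookupAttr_substList] using h')
  | appStep h =>
    simp only [Tm.subst, substList_attachAttr, subst_incAt _ _ (Nat.zero_le n)]
    exact .appStep (by simp [lookupAttr_substList, h])
  | congDot a _ ih => exact .congDot a ih
  | congApp a _ ih => exact .congApp a ih

mutual
theorem Par.incAt : ∀ {t s : Tm L}, Par phi t s → ∀ n, Par phi (t.incAt n) (s.incAt n)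
  | _, _, .loc m, n => by
    simp only [Tm.incAt]
    split <;> exact .loc _
  | _, _, .obj h, n => .obj (h.incAtList (n + 1))
  | _, _, .congDot a h, n => .congDot a (h.incAt n)
  | _, _, .congApp a h h', n => .congApp a (h.incAt n) (h'.incAt n)
  | _, _, .dotPar h hl, n => by
    rw [incAt_subst _ _ (Nat.zero_le n)]
    exact .dotPar (h.incAt n) (by simp [lookupAttr_incAtList, hl])
  | _, _, .dotPhi h hl hp, n =>
    .dotPhi (h.incAt n) (by simp [lookupAttr_incAtList, hl])
      (by simpa [lookupAttr_incAtList] using hp)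
  | _, _, .appPar h hl h', n => by
    simp only [Tm.incAt, incAtList_attachAttr, incAt_incAt _ (Nat.zero_le n)]
    exact .appPar (h.incAt n) (by simp [lookupAttr_incAtList, hl]) (h'.incAt n)

theorem ParAttrs.incAtList : ∀ {l l' : List (L × Option (Tm L))}, ParAttrs phi l l' →
    ∀ n, ParAttrs phi (Tm.incAtList n l) (Tm.incAtList n l')
  | _, _, .nil, _ => .nil
  | _, _, .void a h, n => .void a (h.incAtList n)
  | _, _, .attached a h h', n => .attached a (h.incAt n) (h'.incAtList n)
end

mutual
theorem Par.subst : ∀ {t s : Tm L}, Par phi t s → ∀ (n : Nat) {u v : Tm L}, Par phi u v →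
    Par phi (t.subst n u) (s.subst n v)
  | _, _, .loc m, n, _, _, hu => by
    simp only [Tm.subst]
    split
    · exact .loc _
    · split
      · exact hu
      · exact .loc _
  | _, _, .obj h, n, _, _, hu => .obj (h.substList (n + 1) (hu.incAt 0))
  | _, _, .congDot a h, n, _, _, hu => .congDot a (h.subst n hu)
  | _, _, .congApp a h h', n, _, _, hu => .congApp a (h.subst n hu) (h'.subst n hu)
  | _, _, .dotPar h hl, n, _, _, hu => by
    rw [subst_subst _ _ _ (Nat.zero_le n)]
    exact .dotPar (h.subst n hu) (by simp [lookupAttr_substList, hl])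
  | _, _, .dotPhi h hl hp, n, _, _, hu =>
    .dotPhi (h.subst n hu) (by simp [lookupAttr_substList, hl])
      (by simpa [lookupAttr_substList] using hp)
  | _, _, .appPar h hl h', n, _, _, hu => by
    simp only [Tm.subst, substList_attachAttr, subst_incAt _ _ (Nat.zero_le n)]
    exact .appPar (h.subst n hu) (by simp [lookupAttr_substList, hl]) (h'.subst n hu)

theorem ParAttrs.substList : ∀ {l l' : List (L × Option (Tm L))}, ParAttrs phi l l' →
    ∀ (n : Nat) {u v : Tm L}, Par phi u v →
    ParAttrs phi (Tm.substList l n u) (Tm.substList l' n v)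
  | _, _, .nil, _, _, _, _ => .nil
  | _, _, .void a h, n, _, _, hu => .void a (h.substList n hu)
  | _, _, .attached a h h', n, _, _, hu => .attached a (h.subst n hu) (h'.substList n hu)
end

/-- Reflexive-transitive closure of head reduction. -/
abbrev Heads (phi : L) : Tm L → Tm L → Prop := Relation.ReflTransGen (Head phi)

theorem Heads.congDot {t s : Tm L} (h : Heads phi t s) (a : L) :
    Heads phi (dot t a) (dot s a) :=
  h.lift (dot · a) fun _ _ => Head.congDot a

theorem Heads.congApp {t s : Tm L} (h : Heads phi t s) (a : L) (u : Tm L) :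
    Heads phi (app t a u) (app s a u) :=
  h.lift (app · a u) fun _ _ => Head.congApp a

theorem Heads.incAt {t s : Tm L} (h : Heads phi t s) (n : Nat) :
    Heads phi (t.incAt n) (s.incAt n) :=
  h.lift (Tm.incAt n) fun _ _ h => h.incAt n

theorem Heads.subst {t s : Tm L} (h : Heads phi t s) (n : Nat) (u : Tm L) :
    Heads phi (t.subst n u) (s.subst n u) :=
  h.lift (Tm.subst · n u) fun _ _ h => h.subst n u

mutual
/-- Parallel reductions that factor, hereditarily in all subterms, as head reductions
followed by an internal parallel reduction. -/
inductive ParStd (phi : L) : Tm L → Tm L → Prop where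
  | loc {t : Tm L} {n : Nat} : Par phi t (Tm.loc n) → Heads phi t (Tm.loc n) →
      ParStd phi t (Tm.loc n)
  | dot {t r s : Tm L} {a : L} : Par phi t (Tm.dot s a) → Heads phi t (Tm.dot r a) →
      ParStd phi r s → ParStd phi t (Tm.dot s a)
  | app {t r s u v : Tm L} {a : L} : Par phi t (Tm.app s a v) → Heads phi t (Tm.app r a u) →
      ParStd phi r s → ParStd phi u v → ParStd phi t (Tm.app s a v)
  | obj {t : Tm L} {l l' : List (L × Option (Tm L))} : Par phi t (Tm.obj l') →
      Heads phi t (Tm.obj l) → ParStdAttrs phi l l' → ParStd phi t (Tm.obj l')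

/-- Pointwise extension of `ParStd` to attribute lists. -/
inductive ParStdAttrs (phi : L) :
    List (L × Option (Tm L)) → List (L × Option (Tm L)) → Prop where
  | nil : ParStdAttrs phi [] []
  | void {l l' : List (L × Option (Tm L))} (a : L) :
      ParStdAttrs phi l l' → ParStdAttrs phi ((a, none) :: l) ((a, none) :: l')
  | attached {t s : Tm L} {l l' : List (L × Option (Tm L))} (a : L) :
      ParStd phi t s → ParStdAttrs phi l l' →
      ParStdAttrs phi ((a, some t) :: l) ((a, some s) :: l')
end

theorem ParStd.par {t s : Tm L} (h : ParStd phi t s) : Par phi t s := by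
  cases h <;> assumption

theorem ParStdAttrs.parAttrs : ∀ {l l' : List (L × Option (Tm L))}, ParStdAttrs phi l l' →
    ParAttrs phi l l'
  | _, _, .nil => .nil
  | _, _, .void a h => .void a h.parAttrs
  | _, _, .attached a h h' => .attached a h.par h'.parAttrs

theorem ParStdAttrs.parStd {l l' : List (L × Option (Tm L))} (h : ParStdAttrs phi l l') :
    ParStd phi (obj l) (obj l') :=
  .obj (.obj h.parAttrs) .refl h

theorem ParStd.head_trans {t r s : Tm L} (hp : Par phi t s) (hh : Heads phi t r)
    (h : ParStd phi r s) : ParStd phi t s := by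
  cases h with
  | loc _ h => exact .loc hp (hh.trans h)
  | dot _ h h₁ => exact .dot hp (hh.trans h) h₁
  | app _ h h₁ h₂ => exact .app hp (hh.trans h) h₁ h₂
  | obj _ h h₁ => exact .obj hp (hh.trans h) h₁

mutual
theorem ParStd.incAt : ∀ {t s : Tm L}, ParStd phi t s → ∀ n, ParStd phi (t.incAt n) (s.incAt n)
  | _, _, .loc hp hh, n => by
    refine .head_trans (hp.incAt n) (hh.incAt n) ?_
    simp only [Tm.incAt]
    split <;> exact .loc (.loc _) .refl
  | _, _, .dot hp hh h, n => .dot (hp.incAt n) (hh.incAt n) (h.incAt n)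
  | _, _, .app hp hh h h', n => .app (hp.incAt n) (hh.incAt n) (h.incAt n) (h'.incAt n)
  | _, _, .obj hp hh h, n => .obj (hp.incAt n) (hh.incAt n) (h.incAtList (n + 1))

theorem ParStdAttrs.incAtList : ∀ {l l' : List (L × Option (Tm L))}, ParStdAttrs phi l l' →
    ∀ n, ParStdAttrs phi (Tm.incAtList n l) (Tm.incAtList n l')
  | _, _, .nil, _ => .nil
  | _, _, .void a h, n => .void a (h.incAtList n)
  | _, _, .attached a h h', n => .attached a (h.incAt n) (h'.incAtList n)
end

mutual
theorem ParStd.subst : ∀ {t s : Tm L}, ParStd phi t s → ∀ (n : Nat) {u v : Tm L},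
    ParStd phi u v → ParStd phi (t.subst n u) (s.subst n v)
  | _, _, .loc hp hh, n, u, _, hu => by
    refine .head_trans (hp.subst n hu.par) (hh.subst n u) ?_
    simp only [Tm.subst]
    split
    · exact .loc (.loc _) .refl
    · split
      · exact hu
      · exact .loc (.loc _) .refl
  | _, _, .dot hp hh h, n, u, _, hu =>
    .dot (hp.subst n hu.par) (hh.subst n u) (h.subst n hu)
  | _, _, .app hp hh h h', n, u, _, hu =>
    .app (hp.subst n hu.par) (hh.subst n u) (h.subst n hu) (h'.subst n hu)
  | _, _, .obj hp hh h, n, u, _, hu =>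
    .obj (hp.subst n hu.par) (hh.subst n u) (h.substList (n + 1) (hu.incAt 0))

theorem ParStdAttrs.substList : ∀ {l l' : List (L × Option (Tm L))}, ParStdAttrs phi l l' →
    ∀ (n : Nat) {u v : Tm L}, ParStd phi u v →
    ParStdAttrs phi (Tm.substList l n u) (Tm.substList l' n v)
  | _, _, .nil, _, _, _, _ => .nil
  | _, _, .void a h, n, _, _, hu => .void a (h.substList n hu)
  | _, _, .attached a h h', n, _, _, hu => .attached a (h.subst n hu) (h'.substList n hu)
end

theorem ParStdAttrs.lookupAttr (c : L) : ∀ {l l' : List (L × Option (Tm L))},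
    ParStdAttrs phi l l' → Option.Rel (Option.Rel (ParStd phi)) (lookupAttr c l) (lookupAttr c l')
  | _, _, .nil => .none
  | _, _, .void a h => by
    simp only [Tm.lookupAttr]
    split
    · exact .some .none
    · exact h.lookupAttr c
  | _, _, .attached a h h' => by
    simp only [Tm.lookupAttr]
    split
    · exact .some (.some h)
    · exact h'.lookupAttr c

theorem ParStdAttrs.attachAttr (c : L) {u v : Tm L} (hu : ParStd phi u v) :
    ∀ {l l' : List (L × Option (Tm L))}, ParStdAttrs phi l l' →
    ParStdAttrs phi (attachAttr c u l) (attachAttr c v l')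
  | _, _, .nil => .nil
  | _, _, .void a h => by
    simp only [Tm.attachAttr]
    split
    · exact .attached a hu h
    · exact .void a (h.attachAttr c hu)
  | _, _, .attached a h h' => by
    simp only [Tm.attachAttr]
    split
    · exact .attached a hu h'
    · exact .attached a h (h'.attachAttr c hu)

mutual
theorem Par.parStd : ∀ {t s : Tm L}, Par phi t s → ParStd phi t s
  | _, _, .loc m => .loc (.loc m) .refl
  | _, _, .obj h => h.parStdAttrs.parStd
  | _, _, .congDot a h => .dot (.congDot a h) .refl h.parStd
  | _, _, .congApp a h h' => .app (.congApp a h h') .refl h.parStd h'.parStd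
  | _, _, .dotPar (c := c) h hl => by
    cases h.parStd with
    | @obj _ l₀ _ _ hh ha =>
      have hr := ha.lookupAttr c
      rw [hl] at hr
      generalize hl₀ : Tm.lookupAttr c l₀ = o at hr
      obtain @⟨_, _, @⟨_, _, htc⟩⟩ := hr
      exact .head_trans (.dotPar h hl) ((hh.congDot c).tail (.dotStep hl₀))
        (htc.subst 0 ha.parStd)
  | _, _, .dotPhi (c := c) h hl hp => by
    cases h.parStd with
    | @obj _ l₀ _ _ hh ha =>
      have hr := ha.lookupAttr c
      rw [hl] at hr
      have hr' := ha.lookupAttr phi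
      generalize hl₀ : Tm.lookupAttr c l₀ = o at hr
      obtain ⟨⟩ := hr
      have hp₀ : (Tm.lookupAttr phi l₀).isSome := by
        obtain ⟨o, ho⟩ := Option.isSome_iff_exists.mp hp
        rw [ho] at hr'
        generalize Tm.lookupAttr phi l₀ = o at hr'
        cases hr' with
        | some => rfl
      have hd := ha.parStd
      exact .dot (.dotPhi h hl hp) ((hh.congDot c).tail (.dotPhi hl₀ hp₀))
        (.dot (.congDot phi hd.par) .refl hd)
  | _, _, .appPar (c := c) (u := u) h hl h' => by
    cases h.parStd with
    | @obj _ l₀ _ _ hh ha =>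
      have hr := ha.lookupAttr c
      rw [hl] at hr
      generalize hl₀ : Tm.lookupAttr c l₀ = o at hr
      obtain @⟨_, _, ⟨⟩⟩ := hr
      exact .obj (.appPar h hl h') ((hh.congApp c u).tail (.appStep hl₀))
        (ha.attachAttr c (h'.parStd.incAt 0))

theorem ParAttrs.parStdAttrs : ∀ {l l' : List (L × Option (Tm L))}, ParAttrs phi l l' →
    ParStdAttrs phi l l'
  | _, _, .nil => .nil
  | _, _, .void a h => .void a h.parStdAttrs
  | _, _, .attached a h h' => .attached a h.parStd h'.parStdAttrs
end

theorem ParStd.exists_heads_parI : ∀ {t s : Tm L}, ParStd phi t s →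
    ∃ q, Heads phi t q ∧ ParI phi q s
  | _, _, .loc _ hh => ⟨_, hh, .loc _⟩
  | _, _, .dot _ hh h =>
    have ⟨_, hq, hi⟩ := h.exists_heads_parI
    ⟨_, hh.trans (hq.congDot _), .congDot _ hi⟩
  | _, _, .app _ hh h h' =>
    have ⟨_, hq, hi⟩ := h.exists_heads_parI
    ⟨_, hh.trans (hq.congApp _ _), .congApp _ hi h'.par⟩
  | _, _, .obj _ hh h => ⟨_, hh, .obj h.parAttrs⟩

/-- A parallel reduction factors as head reductions followed by an internal one. -/
theorem Par.exists_heads_parI {t s : Tm L} (h : Par phi t s) :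
    ∃ q, Heads phi t q ∧ ParI phi q s :=
  h.parStd.exists_heads_parI

end Reductions

end Tm
end PhiCalc

open PhiCalc Tm in
/-- Standardizing reductions: if `t ⇛ᵢ r →h s` then there is `q` with
`t →h* q ⇛ᵢ s`. -/
theorem standardizing {L : Type} [DecidableEq L] (phi : L) {t r s : Tm L}
    (h1 : ParI phi t r) (h2 : Head phi r s) :
    ∃ q : Tm L, Relation.ReflTransGen (Head phi) t q ∧ ParI phi q s := by
  induction h2 generalizing t with
  | dotStep h =>
    cases h1 with
    | congDot _ h1 => cases h1 with
      | obj h1 => exact (Par.dotPar (.obj h1) h).exists_heads_parI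
  | dotPhi h h' =>
    cases h1 with
    | congDot _ h1 => cases h1 with
      | obj h1 => exact (Par.dotPhi (.obj h1) h h').exists_heads_parI
  | appStep h =>
    cases h1 with
    | congApp _ h1 hu => cases h1 with
      | obj h1 => exact (Par.appPar (.obj h1) h hu).exists_heads_parI
  | congDot a _ ih =>
    cases h1 with
    | congDot _ h1 =>
      obtain ⟨q, hq, hi⟩ := ih h1
      exact ⟨_, Heads.congDot hq a, .congDot a hi⟩
  | congApp a _ ih =>
    cases h1 with
    | congApp _ h1 hu =>
      obtain ⟨q, hq, hi⟩ := ih h1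
      exact ⟨_, Heads.congApp hq a _, .congApp a hi hu⟩
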